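/- arXiv:2102.09015 — 2 statements merged into one kernel-verified Lean document; each statement's English description precedes it below -/
import Mathlib

section
/- Let R be a commutative Noetherian ring, M a finitely generated R-module, and a, b, I ideals of R with I ⊆ a ∩ b, aM ≠ M, bM ≠ M, bM = IM :_M a and aM = IM :_M b. If aM ∩ bM ≠ IM, then every element of a + b is a zerodivisor on M/IM. -/
/-- The submodule `N :_M c = { m ∈ M | c • m ⊆ N }`. -/
def smulColon {A : Type} [CommRing A] {M : Type} [AddCommGroup M] [Module A M]
    (N : Submodule A M) (c : Ideal A) : Submodule A M :=
  ⨅ r ∈ c, N.comap (DistribMulAction.toLinearMap A M r)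

theorem mem_smulColon {A : Type} [CommRing A] {M : Type} [AddCommGroup M] [Module A M]
    {N : Submodule A M} {c : Ideal A} {m : M} :
    m ∈ smulColon N c ↔ ∀ r ∈ c, r • m ∈ N := by
  simp only [smulColon, Submodule.mem_iInf, Submodule.mem_comap]
  rfl

/-- If `a`, `b` are linked by `I` over `M` (with `I ⊆ a ∩ b`) and
`aM ∩ bM ≠ IM`, then every element of `a + b` is a zerodivisor on `M/IM`. -/
theorem stmt1 (R : Type) [CommRing R] [IsNoetherianRing R]
    (M : Type) [AddCommGroup M] [Module R M] [Module.Finite R M]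
    (a b I : Ideal R) (hI : I ≤ a ⊓ b)
    (haM : (a • ⊤ : Submodule R M) ≠ ⊤) (hbM : (b • ⊤ : Submodule R M) ≠ ⊤)
    (hlink1 : (b • ⊤ : Submodule R M) = smulColon (I • ⊤) a)
    (hlink2 : (a • ⊤ : Submodule R M) = smulColon (I • ⊤) b)
    (hne : (a • ⊤ : Submodule R M) ⊓ (b • ⊤ : Submodule R M) ≠ (I • ⊤ : Submodule R M)) :
    ∀ r ∈ a ⊔ b, ∃ x : M ⧸ (I • ⊤ : Submodule R M), x ≠ 0 ∧ r • x = 0 := by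
  have hle : (I • ⊤ : Submodule R M) ≤ a • ⊤ ⊓ b • ⊤ :=
    le_inf (Submodule.smul_mono_left (hI.trans inf_le_left))
      (Submodule.smul_mono_left (hI.trans inf_le_right))
  obtain ⟨m, ⟨hma, hmb⟩, hm⟩ := SetLike.exists_of_lt (hle.lt_of_ne hne.symm)
  rw [SetLike.mem_coe, hlink2, mem_smulColon] at hma
  rw [SetLike.mem_coe, hlink1, mem_smulColon] at hmb
  intro r hr
  obtain ⟨s, hs, t, ht, rfl⟩ := Submodule.mem_sup.mp hr
  refine ⟨Submodule.Quotient.mk m, by rwa [Ne, Submodule.Quotient.mk_eq_zero], ?_⟩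
  rw [← Submodule.Quotient.mk_smul, Submodule.Quotient.mk_eq_zero, add_smul]
  exact add_mem (hmb s hs) (hma t ht)
end

section
/- Let R_0 be a commutative Noetherian ring, R = R_0[x,y] with the standard grading, M a finitely generated graded R-module, r_1, r_2 ∈ R_0, and suppose r_1 x, r_2 y is an M-regular sequence. Then for all t, t' ≥ 1: (x,y)M = (r_1 x^t, r_2 y^{t'})M :_M (r_1 x^t, r_2 y^{t'}, r_1 r_2 x^{t-1} y^{t'-1}). -/
open RingTheory.Sequence

local notation "R" R₀ => MvPolynomial (Fin 2) R₀

/-- `b` acts injectively on `M / aM`. -/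
def RegularModulo {A : Type} [CommRing A] (M : Type) [AddCommGroup M] [Module A M] (a b : A) :
    Prop :=
  ∀ m n : M, b • m = a • n → ∃ k : M, m = a • k

namespace RegularModulo

variable {A M : Type} [CommRing A] [AddCommGroup M] [Module A M] {a a' b b' : A}

lemma one_left : RegularModulo M 1 b := fun m _ _ => ⟨m, (one_smul A m).symm⟩

lemma one_right : RegularModulo M a 1 := fun _ n h => ⟨n, by rwa [one_smul] at h⟩

lemma mul_right (h : RegularModulo M a b) (h' : RegularModulo M a b') :
    RegularModulo M a (b * b') := by
  intro m n e
  rw [mul_smul] at e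
  obtain ⟨k, hk⟩ := h _ _ e
  exact h' _ _ hk

lemma mul_left (ha : IsSMulRegular M a) (h : RegularModulo M a b) (h' : RegularModulo M a' b) :
    RegularModulo M (a * a') b := by
  intro m n e
  rw [mul_smul] at e
  obtain ⟨k, rfl⟩ := h _ _ e
  rw [smul_comm] at e
  obtain ⟨l, rfl⟩ := h' _ _ (ha e)
  exact ⟨l, smul_smul _ _ _⟩

lemma of_mul_left (ha' : IsSMulRegular M a') (h : RegularModulo M (a * a') b) :
    RegularModulo M a b := by
  intro m n e
  obtain ⟨k, hk⟩ := h (a' • m) n (by rw [smul_comm, e, mul_comm, mul_smul])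
  refine ⟨k, ha' ?_⟩
  change a' • m = a' • a • k
  rw [hk, mul_comm, mul_smul]

lemma of_mul_right (h : RegularModulo M a (b * b')) : RegularModulo M a b := by
  intro m n e
  exact h m (b' • n) (by rw [mul_comm, mul_smul, e, smul_comm])

lemma pow_right (h : RegularModulo M a b) (n : ℕ) : RegularModulo M a (b ^ n) := by
  induction n with
  | zero => rw [pow_zero]; exact one_right
  | succ n ih => rw [pow_succ]; exact ih.mul_right h

lemma pow_left (ha : IsSMulRegular M a) (h : RegularModulo M a b) (n : ℕ) :
    RegularModulo M (a ^ n) b := by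
  induction n with
  | zero => rw [pow_zero]; exact one_left
  | succ n ih => rw [pow_succ]; exact mul_left (ha.pow n) ih h

end RegularModulo

lemma regularModulo_of_isWeaklyRegular_pair {A M : Type} [CommRing A] [AddCommGroup M]
    [Module A M] {a b : A} (h : IsWeaklyRegular M [a, b]) :
    IsSMulRegular M a ∧ RegularModulo M a b := by
  rw [isWeaklyRegular_cons_iff, isWeaklyRegular_singleton_iff] at h
  refine ⟨h.1, fun m n e => ?_⟩
  obtain ⟨k, -, hk⟩ := mem_of_isSMulRegular_quotient_of_smul_mem h.2
    (e ▸ Submodule.smul_mem_pointwise_smul n a ⊤ trivial)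
  exact ⟨k, hk.symm⟩

lemma mem_span_pair_smul_top {A M : Type} [CommRing A] [AddCommGroup M] [Module A M]
    {a b : A} {m : M} :
    m ∈ (Ideal.span {a, b} • ⊤ : Submodule A M) ↔ ∃ u v : M, m = a • u + b • v := by
  rw [Ideal.span_insert, Submodule.sup_smul, Submodule.mem_sup]
  simp only [Submodule.ideal_span_singleton_smul, Submodule.mem_smul_pointwise_iff_exists,
    Submodule.mem_top, true_and]
  constructor
  · rintro ⟨_, ⟨u, rfl⟩, _, ⟨v, rfl⟩, rfl⟩
    exact ⟨u, v, rfl⟩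
  · rintro ⟨u, v, rfl⟩
    exact ⟨_, ⟨u, rfl⟩, _, ⟨v, rfl⟩, rfl⟩

lemma mem_smulColon_span {A M : Type} [CommRing A] [AddCommGroup M] [Module A M]
    {N : Submodule A M} {s : Set A} {m : M} :
    m ∈ smulColon N (Ideal.span s) ↔ ∀ r ∈ s, r • m ∈ N := by
  simp only [smulColon, Submodule.mem_iInf, Submodule.mem_comap]
  refine ⟨fun h r hr => h r (Ideal.subset_span hr), fun h r hr => ?_⟩
  have hle : Ideal.span s ≤ N.comap (LinearMap.toSpanSingleton A M m) := Ideal.span_le.2 h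
  exact hle hr

/-- If `r₁x, r₂y` is weakly `M`-regular, then
`(x,y)M = (r₁xⁿ⁺¹, r₂yᵏ⁺¹)M :_M (r₁xⁿ⁺¹, r₂yᵏ⁺¹, r₁r₂xⁿyᵏ)`. -/
lemma span_pair_smul_top_eq_smulColon {A M : Type} [CommRing A] [AddCommGroup M] [Module A M]
    {r₁ r₂ x y : A} (hreg : IsWeaklyRegular M [r₁ * x, r₂ * y]) (n k : ℕ) :
    (Ideal.span {x, y} • ⊤ : Submodule A M) =
      smulColon (Ideal.span {r₁ * x ^ (n + 1), r₂ * y ^ (k + 1)} • ⊤)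
        (Ideal.span {r₁ * x ^ (n + 1), r₂ * y ^ (k + 1), r₁ * r₂ * x ^ n * y ^ k}) := by
  obtain ⟨hnzd, hmod⟩ := regularModulo_of_isWeaklyRegular_pair hreg
  have hx : IsSMulRegular M x := hnzd.of_mul
  have hr₁ : IsSMulRegular M r₁ := (mul_comm r₁ x ▸ hnzd).of_mul
  have hmod_r₁ : RegularModulo M r₁ (r₂ * y) := hmod.of_mul_left hx
  have hmod_x : RegularModulo M x (r₂ * y) := (mul_comm r₁ x ▸ hmod).of_mul_left hr₁
  have hpow {a : A} (h : RegularModulo M a (r₂ * y)) (j : ℕ) : RegularModulo M a (r₂ * y ^ j) :=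
    h.of_mul_right.mul_right ((mul_comm r₂ y ▸ h).of_mul_right.pow_right j)
  ext m
  rw [mem_span_pair_smul_top, mem_smulColon_span]
  simp only [Set.mem_insert_iff, Set.mem_singleton_iff, forall_eq_or_imp, forall_eq,
    mem_span_pair_smul_top]
  constructor
  · rintro ⟨u, v, rfl⟩
    refine ⟨⟨x • u + y • v, 0, by simp⟩, ⟨0, x • u + y • v, by simp⟩,
      (r₂ * y ^ k) • u, (r₁ * x ^ n) • v, ?_⟩
    module
  · rintro ⟨-, -, u, v, e⟩
    have e₁ : (r₂ * y ^ (k + 1)) • v = (r₁ * x ^ n) • ((r₂ * y ^ k) • m - x • u) := by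
      rw [eq_sub_of_add_eq' e.symm]
      module
    obtain ⟨w, rfl⟩ :=
      RegularModulo.mul_left hr₁ (hpow hmod_r₁ _) ((hpow hmod_x _).pow_left hx n) _ _ e₁
    rw [smul_comm] at e₁
    have e₂ : (r₂ * y ^ (k + 1)) • w = (r₂ * y ^ k) • m - x • u := (hr₁.mul (hx.pow n)) e₁
    obtain ⟨z, hz⟩ := hpow hmod_x k (m - y • w) u (by
      rw [smul_sub, smul_smul, mul_assoc, ← pow_succ, e₂, sub_sub_cancel])
    exact ⟨z, w, by rw [← hz, sub_add_cancel]⟩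

/-- Over `R = R₀[x,y]`, if `r₁x, r₂y` is an `M`-regular sequence, then
for all `t, t' ≥ 1`:
`(x,y)M = (r₁xᵗ, r₂y^{t'})M :_M (r₁xᵗ, r₂y^{t'}, r₁r₂x^{t-1}y^{t'-1})`. -/
theorem stmt4 (R₀ : Type) [CommRing R₀] [IsNoetherianRing R₀]
    (M : Type) [AddCommGroup M] [Module (R R₀) M] [Module.Finite (R R₀) M]
    -- the grading on `M`
    (ℳ : ℤ → AddSubgroup M) [DirectSum.Decomposition ℳ]
    (hgr : ∀ (j : ℤ) (p : R R₀) (d : ℕ), p.IsHomogeneous d → ∀ m ∈ ℳ j, p • m ∈ ℳ (j + d))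
    (r₁ r₂ : R₀) (t t' : ℕ) (ht : 1 ≤ t) (ht' : 1 ≤ t')
    (hreg : IsRegular M [(MvPolynomial.C r₁ * MvPolynomial.X (0 : Fin 2) : R R₀),
                          MvPolynomial.C r₂ * MvPolynomial.X (1 : Fin 2)]) :
    (Ideal.span {(MvPolynomial.X (0 : Fin 2) : R R₀), MvPolynomial.X (1 : Fin 2)} • ⊤ : Submodule (R R₀) M)
      = smulColon
          (Ideal.span {MvPolynomial.C r₁ * MvPolynomial.X (0 : Fin 2) ^ t,
              MvPolynomial.C r₂ * MvPolynomial.X (1 : Fin 2) ^ t'} • ⊤)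
          (Ideal.span {MvPolynomial.C r₁ * MvPolynomial.X (0 : Fin 2) ^ t,
              MvPolynomial.C r₂ * MvPolynomial.X (1 : Fin 2) ^ t',
              MvPolynomial.C r₁ * MvPolynomial.C r₂ *
                MvPolynomial.X (0 : Fin 2) ^ (t - 1) * MvPolynomial.X (1 : Fin 2) ^ (t' - 1)}) := by
  obtain ⟨n, rfl⟩ := Nat.exists_eq_add_of_le' ht
  obtain ⟨k, rfl⟩ := Nat.exists_eq_add_of_le' ht'
  exact span_pair_smul_top_eq_smulColon hreg.toIsWeaklyRegular n k
end
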